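/- Let G : ℝ^n → ℝ satisfy ‖∇G(w)‖_∞ ≤ M at every point w where G is differentiable, with G Lipschitz (so differentiable almost everywhere), let u > 0, and let G_μ(x) = E_{z∼μ(u)}[G(x + z)] where μ(u) is the uniform distribution on the ℓ∞ ball of radius u. Then the gradient of G_μ is (M/u)-Lipschitz continuous in the ℓ1 norm: ‖∇G_μ(x) − ∇G_μ(y)‖_∞ ≤ (M/u)‖x − y‖₁ for all x, y ∈ ℝ^n. -/

import Mathlib

open MeasureTheory

/-- The smoothed version of `G`: the average of `G` over the ℓ∞ ball of radius `u`
centered at `x` (note the sup norm is the norm of the Pi space `Fin n → ℝ`). -/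
noncomputable def smoothed {n : ℕ} (G : (Fin n → ℝ) → ℝ) (u : ℝ) (x : Fin n → ℝ) : ℝ :=
  ((2 * u) ^ n)⁻¹ * ∫ z in Metric.closedBall (0 : Fin n → ℝ) u, G (x + z)

open Metric in
theorem hasFDerivAt_smoothed {n : ℕ} {G : (Fin n → ℝ) → ℝ} {K : NNReal}
    (hLip : LipschitzWith K G) (u : ℝ) (x : Fin n → ℝ) :
    IntegrableOn (fun z => fderiv ℝ G (x + z)) (closedBall 0 u) ∧
      HasFDerivAt (smoothed G u)
        (((2 * u) ^ n)⁻¹ • ∫ z in closedBall (0 : Fin n → ℝ) u, fderiv ℝ G (x + z)) x := by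
  have hcont : ∀ y, Continuous fun z => G (y + z) := fun y =>
    hLip.continuous.comp (continuous_const.add continuous_id)
  have hdiff : ∀ᵐ z : Fin n → ℝ, DifferentiableAt ℝ G (x + z) :=
    (measurePreserving_add_left volume x).quasiMeasurePreserving.ae
      (hLip.ae_differentiableAt (μ := volume))
  have h := hasFDerivAt_integral_of_dominated_loc_of_lip (𝕜 := ℝ)
    (μ := volume.restrict (closedBall (0 : Fin n → ℝ) u)) (F := fun y z => G (y + z))
    (F' := fun z => fderiv ℝ G (x + z)) (x₀ := x) (bound := fun _ => (K : ℝ))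
    Filter.univ_mem
    (Filter.Eventually.of_forall fun y => (hcont y).aestronglyMeasurable)
    ((hcont x).continuousOn.integrableOn_compact (isCompact_closedBall _ _))
    (((measurable_fderiv ℝ G).comp (measurable_const_add x)).aestronglyMeasurable)
    (Filter.Eventually.of_forall fun z => by
      refine LipschitzOnWith.of_dist_le_mul fun a _ b _ => ?_
      simpa using hLip.dist_le_mul (a + z) (b + z))
    (integrableOn_const measure_closedBall_lt_top.ne)
    (ae_restrict_of_ae (hdiff.mono fun z hz => (hasFDerivAt_comp_add_right z).2 hz.hasFDerivAt))
  exact ⟨h.1, h.2.const_mul _⟩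

open Metric in
theorem fderiv_smoothed_apply {n : ℕ} {G : (Fin n → ℝ) → ℝ} {K : NNReal}
    (hLip : LipschitzWith K G) (u : ℝ) (x v : Fin n → ℝ) :
    fderiv ℝ (smoothed G u) x v =
      ((2 * u) ^ n)⁻¹ * ∫ w in closedBall x u, fderiv ℝ G w v := by
  obtain ⟨hint, hderiv⟩ := hasFDerivAt_smoothed hLip u x
  have hpre : (x + ·) ⁻¹' closedBall x u = closedBall (0 : Fin n → ℝ) u := by
    ext z; simp
  rw [hderiv.fderiv, smul_apply, ContinuousLinearMap.integral_apply hint,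
    smul_eq_mul, ← hpre, (measurePreserving_add_left volume x).setIntegral_preimage_emb
      (measurableEmbedding_addLeft x) (fun w => fderiv ℝ G w v)]

theorem pow_card_mul_one_sub_sum_div_le_prod_max {ι : Type*} (s : Finset ι) {a : ℝ} (ha : 0 < a)
    {d : ι → ℝ} (hd : ∀ i ∈ s, 0 ≤ d i) :
    a ^ s.card * (1 - (∑ i ∈ s, d i) / a) ≤ ∏ i ∈ s, max (a - d i) 0 := by
  classical
  induction s using Finset.induction_on with
  | empty => simp
  | insert j s hj ih =>
    have hs : ∀ i ∈ s, 0 ≤ d i := fun i hi => hd i (Finset.mem_insert_of_mem hi)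
    have hdj : 0 ≤ d j := hd j (Finset.mem_insert_self j s)
    have hP : 0 ≤ ∏ i ∈ s, max (a - d i) 0 := Finset.prod_nonneg fun i _ => le_max_right _ _
    have hPa : ∏ i ∈ s, max (a - d i) 0 ≤ a ^ s.card :=
      (Finset.prod_le_prod (fun i _ => le_max_right _ _) fun i hi =>
        max_le (by linarith [hs i hi]) ha.le).trans_eq (Finset.prod_const a)
    rw [Finset.sum_insert hj, Finset.prod_insert hj, Finset.card_insert_of_notMem hj]
    calc a ^ (s.card + 1) * (1 - (d j + ∑ i ∈ s, d i) / a)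
        = a * (a ^ s.card * (1 - (∑ i ∈ s, d i) / a)) - d j * a ^ s.card := by
          field_simp; ring
      _ ≤ a * (∏ i ∈ s, max (a - d i) 0) - d j * ∏ i ∈ s, max (a - d i) 0 := by
          gcongr; exact ih hs
      _ = (a - d j) * ∏ i ∈ s, max (a - d i) 0 := by ring
      _ ≤ max (a - d j) 0 * ∏ i ∈ s, max (a - d i) 0 := by
          gcongr; exact le_max_left _ _

theorem closedBall_pi_eq_Icc {ι : Type*} [Fintype ι] (x : ι → ℝ) {u : ℝ} (hu : 0 ≤ u) :
    Metric.closedBall x u = Set.Icc (fun i => x i - u) (fun i => x i + u) := by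
  simp_rw [closedBall_pi x hu, Real.closedBall_eq_Icc, Set.pi_univ_Icc]

theorem volume_real_closedBall_inter_closedBall {ι : Type*} [Fintype ι] (x y : ι → ℝ) {u : ℝ}
    (hu : 0 ≤ u) :
    volume.real (Metric.closedBall x u ∩ Metric.closedBall y u) =
      ∏ i, max (2 * u - |x i - y i|) 0 := by
  rw [closedBall_pi_eq_Icc x hu, closedBall_pi_eq_Icc y hu, Set.Icc_inter_Icc, measureReal_def,
    Real.volume_Icc_pi, ENNReal.toReal_prod]
  refine Finset.prod_congr rfl fun i _ => ?_
  rw [ENNReal.toReal_ofReal']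
  congr 1
  simp only [Pi.sup_apply, Pi.inf_apply]
  rcases le_total (x i) (y i) with h | h
  · rw [sup_eq_right.2 (by linarith), inf_eq_left.2 (by linarith),
      abs_of_nonpos (by linarith)]
    ring
  · rw [sup_eq_left.2 (by linarith), inf_eq_right.2 (by linarith),
      abs_of_nonneg (by linarith)]
    ring

theorem volume_real_closedBall_sdiff_closedBall_le {ι : Type*} [Fintype ι] (x y : ι → ℝ) {u : ℝ}
    (hu : 0 < u) :
    volume.real (Metric.closedBall x u \ Metric.closedBall y u) ≤
      (2 * u) ^ Fintype.card ι * ((∑ i, |x i - y i|) / (2 * u)) := by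
  have hinter := pow_card_mul_one_sub_sum_div_le_prod_max Finset.univ (a := 2 * u) (by positivity)
    (d := fun i => |x i - y i|) fun i _ => abs_nonneg _
  rw [← volume_real_closedBall_inter_closedBall x y hu.le, Finset.card_univ] at hinter
  have hball : volume.real (Metric.closedBall x u) = (2 * u) ^ Fintype.card ι := by
    rw [measureReal_def, Real.volume_pi_closedBall x hu.le, ENNReal.toReal_ofReal (by positivity)]
  have hsplit := measureReal_inter_add_sdiff (μ := volume) (s := Metric.closedBall x u)
    (t := Metric.closedBall y u) Metric.isClosed_closedBall.measurableSet
    measure_closedBall_lt_top.ne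
  linarith

theorem abs_setIntegral_sub_setIntegral_le {α : Type*} [MeasurableSpace α] {μ : Measure α}
    {f : α → ℝ} {C : ℝ} (hf : ∀ a, ‖f a‖ ≤ C) {s t : Set α} (hs : MeasurableSet s)
    (ht : MeasurableSet t) (hfs : IntegrableOn f s μ) (hft : IntegrableOn f t μ)
    (hμs : μ s ≠ ⊤) (hμt : μ t ≠ ⊤) :
    |∫ a in s, f a ∂μ - ∫ a in t, f a ∂μ| ≤ C * (μ.real (s \ t) + μ.real (t \ s)) := by
  rw [← integral_inter_add_sdiff ht hfs, ← integral_inter_add_sdiff hs hft, Set.inter_comm t s,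
    add_sub_add_left_eq_sub, mul_add]
  refine (abs_sub _ _).trans (add_le_add ?_ ?_)
  · exact norm_setIntegral_le_of_norm_le_const (measure_ne_top_of_subset Set.sdiff_subset hμs).lt_top
      fun a _ => hf a
  · exact norm_setIntegral_le_of_norm_le_const (measure_ne_top_of_subset Set.sdiff_subset hμt).lt_top
      fun a _ => hf a

/-- Suppose `G : ℝ^n → ℝ` is Lipschitz and `‖∇G(w)‖_∞ ≤ M` at every
point `w` where `G` is differentiable, and let `u > 0`. Then the gradient of the
smoothed function `G_μ` is `(M/u)`-Lipschitz from the ℓ1 norm to the ℓ∞ norm: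
every coordinate of `∇G_μ(x) - ∇G_μ(y)` is at most `(M/u) ‖x - y‖₁` in absolute value. -/
theorem stmt_6 {n : ℕ} (G : (Fin n → ℝ) → ℝ) (K : NNReal) (hLip : LipschitzWith K G)
    (M : ℝ) (hM : ∀ w : Fin n → ℝ, DifferentiableAt ℝ G w →
      ∀ i : Fin n, |fderiv ℝ G w (Pi.single i 1)| ≤ M)
    (u : ℝ) (hu : 0 < u) :
    ∀ x y : Fin n → ℝ, ∀ i : Fin n,
      |fderiv ℝ (smoothed G u) x (Pi.single i 1) -
          fderiv ℝ (smoothed G u) y (Pi.single i 1)| ≤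
        (M / u) * ∑ j, |x j - y j| := by
  intro x y i
  obtain ⟨w₀, hw₀⟩ := (hLip.ae_differentiableAt (μ := volume)).exists
  have hM0 : 0 ≤ M := (abs_nonneg _).trans (hM w₀ hw₀ i)
  have hbound : ∀ w, |fderiv ℝ G w (Pi.single i 1)| ≤ M := fun w => by
    by_cases hw : DifferentiableAt ℝ G w
    · exact hM w hw i
    · simpa [fderiv_zero_of_not_differentiableAt hw] using hM0
  have hint : ∀ c : Fin n → ℝ,
      IntegrableOn (fun w => fderiv ℝ G w (Pi.single i 1)) (Metric.closedBall c u) := fun c =>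
    Measure.integrableOn_of_bounded measure_closedBall_lt_top.ne
      (measurable_fderiv_apply_const ℝ G _).aestronglyMeasurable
      (Filter.Eventually.of_forall hbound)
  have hxy := volume_real_closedBall_sdiff_closedBall_le x y hu
  have hyx := volume_real_closedBall_sdiff_closedBall_le y x hu
  simp_rw [abs_sub_comm (y _) (x _)] at hyx
  rw [Fintype.card_fin] at hxy hyx
  rw [fderiv_smoothed_apply hLip, fderiv_smoothed_apply hLip, ← mul_sub, abs_mul,
    abs_of_pos (by positivity : 0 < ((2 * u) ^ n)⁻¹)]
  calc _ ≤ ((2 * u) ^ n)⁻¹ * (M * ((2 * u) ^ n * ((∑ j, |x j - y j|) / (2 * u)) +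
          (2 * u) ^ n * ((∑ j, |x j - y j|) / (2 * u)))) := by
        gcongr
        refine (abs_setIntegral_sub_setIntegral_le hbound Metric.isClosed_closedBall.measurableSet
          Metric.isClosed_closedBall.measurableSet (hint x) (hint y)
          measure_closedBall_lt_top.ne measure_closedBall_lt_top.ne).trans ?_
        gcongr
    _ = _ := by
        field_simp
        ring
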